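/- Let n ≥ 1, let Δ := { s ∈ [0,1]^{n−1} : s₁+…+s_{n−1} ≤ 1 }, and define ψ₁: Δ × [0,2π)^n → ℂ^n by ψ₁(s,t) := ( √s₁·e^{it₁}, …, √s_{n−1}·e^{it_{n−1}}, √(1−s)·e^{itₙ} ), where s = s₁+…+s_{n−1}. Then the measure σ on the unit sphere S of ℂ^n defined by ∫_S f dσ := ∫_{Δ × [0,2π)^n} f(ψ₁(s,t)) ds dt is U(n)-invariant: for every unitary matrix A ∈ U(n) and every continuous function f on S, ∫_{Δ × [0,2π)^n} f(A·ψ₁(s,t)) ds dt = ∫_{Δ × [0,2π)^n} f(ψ₁(s,t)) ds dt. -/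

import Mathlib

open MeasureTheory Matrix

/-- The parametrization `ψ₁(s,t) = (√s₁ e^{it₁}, …, √s_{n-1} e^{it_{n-1}}, √(1-s) e^{itₙ})`
of the unit sphere of `ℂ^n`, where `s = s₁ + … + s_{n-1}`. -/
noncomputable def psi1 (n : ℕ) : ((Fin (n - 1) → ℝ) × (Fin n → ℝ)) → (Fin n → ℂ) := fun p i =>
  if h : (i : ℕ) < n - 1 then
    ((Real.sqrt (p.1 ⟨(i : ℕ), h⟩) : ℝ) : ℂ) * Complex.exp (Complex.I * ((p.2 i : ℝ) : ℂ))
  else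
    ((Real.sqrt (1 - ∑ j, p.1 j) : ℝ) : ℂ) * Complex.exp (Complex.I * ((p.2 i : ℝ) : ℂ))

open scoped ENNReal

/-- In the coordinates `(|z|², arg z)`, Lebesgue measure on `ℂ` is half of Lebesgue measure. -/
lemma measurePreserving_sqrt_mul_exp :
    MeasurePreserving
      (fun q : ℝ × ℝ => ((Real.sqrt q.1 : ℝ) : ℂ) * Complex.exp (Complex.I * ((q.2 : ℝ) : ℂ)))
      ((volume.restrict (Set.Ici 0)).prod (volume.restrict (Set.Ico 0 (2 * Real.pi))))
      ((2 : ℝ≥0∞) • (volume : Measure ℂ)) := by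
  have hmeas : Measurable
      (fun q : ℝ × ℝ => ((Real.sqrt q.1 : ℝ) : ℂ) * Complex.exp (Complex.I * ((q.2 : ℝ) : ℂ))) := by
    fun_prop
  refine ⟨hmeas, Measure.ext_of_lintegral _ fun f hf => ?_⟩
  rw [lintegral_map hf hmeas, lintegral_smul_measure, ← lintegral_neg_eq_self f,
    ← Complex.lintegral_comp_polarCoord_symm, polarCoord_target,
    Measure.volume_eq_prod, ← Measure.prod_restrict, lintegral_prod _ (by fun_prop),
    lintegral_prod _ (by
      simp only [Complex.polarCoord_symm_apply]
      fun_prop), Measure.restrict_congr_set Ioi_ae_eq_Ici.symm]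
  have himage : (fun r : ℝ => r ^ 2) '' Set.Ioi 0 = Set.Ioi 0 := by
    ext u
    constructor
    · rintro ⟨r, hr, rfl⟩
      exact pow_pos (Set.mem_Ioi.1 hr) 2
    · intro hu
      exact ⟨√u, Real.sqrt_pos.2 hu, Real.sq_sqrt (le_of_lt hu)⟩
  have hinj : Set.InjOn (fun r : ℝ => r ^ 2) (Set.Ioi 0) := fun a ha b hb h =>
    (pow_left_inj₀ (le_of_lt ha) (le_of_lt hb) two_ne_zero).1 h
  nth_rewrite 1 [← himage]
  rw [lintegral_image_eq_lintegral_abs_deriv_mul (f' := fun r => 2 * r) measurableSet_Ioi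
    (fun x _ => by simpa using (hasDerivAt_pow 2 x).hasDerivWithinAt) hinj, smul_eq_mul,
    ← lintegral_const_mul' _ _ (by simp)]
  refine setLIntegral_congr_fun measurableSet_Ioi fun r hr => ?_
  have hr0 : (0 : ℝ) < r := hr
  simp only [smul_eq_mul]
  rw [lintegral_const_mul' _ _ (by simp), ← mul_assoc, abs_of_pos (by positivity),
    ENNReal.ofReal_mul zero_le_two, Real.sqrt_sq hr0.le, ENNReal.ofReal_ofNat,
    Measure.restrict_congr_set (Ioo_ae_eq_Ico (a := -Real.pi) (b := Real.pi)),
    ← lintegral_indicator measurableSet_Ico, ← lintegral_indicator measurableSet_Ico,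
    ← lintegral_sub_right_eq_self
      (fun θ => (Set.Ico (-Real.pi) Real.pi).indicator _ θ) Real.pi]
  congr 1
  refine lintegral_congr fun t => ?_
  have hmem : t - Real.pi ∈ Set.Ico (-Real.pi) Real.pi ↔ t ∈ Set.Ico 0 (2 * Real.pi) := by
    simp only [Set.mem_Ico]
    constructor <;> rintro ⟨h1, h2⟩ <;> constructor <;> linarith
  simp only [Set.indicator_apply, hmem, Complex.polarCoord_symm_apply]
  congr 2
  rw [mul_comm Complex.I, Complex.exp_mul_I, Real.cos_sub_pi, Real.sin_sub_pi]
  push_cast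
  ring

/-- A unitary matrix preserves the sum of the squared moduli of the coordinates. -/
lemma sum_normSq_mulVec {n : ℕ} {A : Matrix (Fin n) (Fin n) ℂ}
    (hA : A ∈ Matrix.unitaryGroup (Fin n) ℂ) (v : Fin n → ℂ) :
    ∑ i, Complex.normSq (A.mulVec v i) = ∑ i, Complex.normSq (v i) := by
  have hdot : ∀ w : Fin n → ℂ, ((∑ i, Complex.normSq (w i) : ℝ) : ℂ) = star w ⬝ᵥ w := fun w => by
    simp [dotProduct, Complex.normSq_eq_conj_mul_self]
  refine Complex.ofReal_injective ?_
  rw [hdot, hdot, Matrix.star_mulVec, Matrix.dotProduct_mulVec, Matrix.vecMul_vecMul,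
    ← Matrix.star_eq_conjTranspose, Matrix.UnitaryGroup.star_mul_self ⟨A, hA⟩, Matrix.vecMul_one]

/-- A unitary matrix preserves every Haar measure on `ℂ^n`. -/
lemma measurePreserving_mulVec_of_mem_unitaryGroup {n : ℕ} {A : Matrix (Fin n) (Fin n) ℂ}
    (hA : A ∈ Matrix.unitaryGroup (Fin n) ℂ) (μ : Measure (Fin n → ℂ)) [μ.IsAddHaarMeasure] :
    MeasurePreserving A.mulVec μ μ := by
  have hdet : Complex.normSq A.det = 1 := by
    have h := (Matrix.det_of_mem_unitary hA).2
    rw [Complex.star_def, Complex.mul_conj] at h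
    exact_mod_cast h
  have hdet' : LinearMap.det ((Matrix.toLin' A).restrictScalars ℝ) = 1 := by
    rw [LinearMap.det_restrictScalars, LinearMap.det_toLin', Algebra.norm_complex_apply, hdet]
  have h := Measure.map_linearMap_addHaar_eq_smul_addHaar μ
    (f := (Matrix.toLin' A).restrictScalars ℝ) (by rw [hdet']; exact one_ne_zero)
  rw [hdet'] at h
  exact ⟨(Continuous.matrix_mulVec continuous_const continuous_id).measurable,
    h.trans (by simp)⟩

/-- Integration over the positive orthant of `ℝ^(m+1)` in terms of the sum `R` of the coordinates
and the point of the standard simplex obtained by dividing by `R`. -/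
lemma lintegral_pi_Ici_eq_lintegral_simplex {m : ℕ} {H : (Fin (m + 1) → ℝ) → ℝ≥0∞}
    (hH : Measurable H) :
    ∫⁻ u in Set.univ.pi fun _ => Set.Ici 0, H u
      = ∫⁻ R in Set.Ioi (0 : ℝ), ENNReal.ofReal (R ^ m) *
          ∫⁻ s in {s : Fin m → ℝ | (∀ i, 0 ≤ s i) ∧ ∑ i, s i ≤ 1},
            H (R • (Fin.snoc s (1 - ∑ i, s i) : Fin (m + 1) → ℝ)) := by
  have hS : MeasurableSet (Set.univ.pi fun _ : Fin (m + 1) => Set.Ici (0 : ℝ)) :=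
    MeasurableSet.univ_pi fun _ => measurableSet_Ici
  have hT : MeasurableSet {s : Fin m → ℝ | (∀ i, 0 ≤ s i) ∧ ∑ i, s i ≤ 1} := by
    measurability
  rw [← lintegral_indicator hS, ← lintegral_indicator measurableSet_Ioi]
  set J := (Set.univ.pi fun _ : Fin (m + 1) => Set.Ici (0 : ℝ)).indicator H with hJ
  have hJm : Measurable J := hH.indicator hS
  have hsnoc : Measurable
      (fun p : ℝ × (Fin m → ℝ) => (Fin.snoc p.2 p.1 : Fin (m + 1) → ℝ)) := by
    refine measurable_pi_iff.2 fun i => ?_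
    refine Fin.lastCases ?_ (fun i => ?_) i
    · simpa using measurable_fst
    · simp only [Fin.snoc_castSucc]
      fun_prop
  have hsplit : ∫⁻ u, J u = ∫⁻ p : ℝ × (Fin m → ℝ), J (Fin.snoc p.2 p.1) := by
    rw [← (volume_preserving_piFinSuccAbove (fun _ : Fin (m + 1) => ℝ)
      (Fin.last m)).symm.lintegral_comp hJm]
    refine lintegral_congr fun p => ?_
    congr 1
    exact Fin.insertNth_last' p.1 p.2
  rw [hsplit, Measure.volume_eq_prod, lintegral_prod_symm
    (fun p : ℝ × (Fin m → ℝ) => J (Fin.snoc p.2 p.1)) (hJm.comp hsnoc).aemeasurable]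
  have hshift : ∀ v : Fin m → ℝ, ∫⁻ x : ℝ, J (Fin.snoc v x)
      = ∫⁻ R : ℝ, J (Fin.snoc v (R - ∑ i, v i)) := fun v =>
    (lintegral_sub_right_eq_self (fun x => J (Fin.snoc v x)) (∑ i, v i)).symm
  simp only [hshift]
  have hm2 : Measurable
      (fun p : (Fin m → ℝ) × ℝ => J (Fin.snoc p.1 (p.2 - ∑ i, p.1 i))) :=
    hJm.comp (hsnoc.comp (f := fun p : (Fin m → ℝ) × ℝ => (p.2 - ∑ i, p.1 i, p.1))
      (by fun_prop))
  rw [lintegral_lintegral_swap hm2.aemeasurable]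
  refine lintegral_congr_ae ?_
  filter_upwards [Measure.ae_ne volume (0 : ℝ)] with R hR
  rcases lt_or_gt_of_ne hR with hneg | hpos
  · rw [Set.indicator_of_notMem (by simpa using hneg.le)]
    refine (lintegral_congr fun v => ?_).trans lintegral_zero
    rw [hJ, Set.indicator_of_notMem]
    intro hmem
    have h0 : ∀ i, 0 ≤ v i := fun i => by
      simpa using hmem (Fin.castSucc i) (Set.mem_univ _)
    have h1 : 0 ≤ R - ∑ i, v i := by
      simpa using hmem (Fin.last m) (Set.mem_univ _)
    linarith [Finset.sum_nonneg fun i (_ : i ∈ Finset.univ) => h0 i]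
  · rw [Set.indicator_of_mem (Set.mem_Ioi.2 hpos)]
    have hφ : Measurable fun v : Fin m → ℝ => J (Fin.snoc v (R - ∑ i, v i)) :=
      hm2.comp (measurable_id.prodMk measurable_const)
    have hscale : ∫⁻ v : Fin m → ℝ, J (Fin.snoc v (R - ∑ i, v i))
        = ENNReal.ofReal (R ^ m) *
          ∫⁻ s : Fin m → ℝ, J (Fin.snoc (R • s) (R - ∑ i, (R • s) i)) := by
      rw [← lintegral_map (f := fun v : Fin m → ℝ => J (Fin.snoc v (R - ∑ i, v i)))
        (g := fun s : Fin m → ℝ => R • s) hφ (measurable_const_smul R),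
        Measure.map_addHaar_smul volume hR, lintegral_smul_measure, smul_eq_mul, ← mul_assoc,
        ← ENNReal.ofReal_mul (by positivity), Module.finrank_fin_fun,
        abs_of_pos (by positivity), mul_inv_cancel₀ (by positivity), ENNReal.ofReal_one, one_mul]
    rw [hscale, ← lintegral_indicator hT]
    congr 1
    refine lintegral_congr fun s => ?_
    have hpoint : (Fin.snoc (R • s) (R - ∑ i, (R • s) i) : Fin (m + 1) → ℝ)
        = R • (Fin.snoc s (1 - ∑ i, s i) : Fin (m + 1) → ℝ) := by
      ext i
      refine Fin.lastCases ?_ (fun i => ?_) i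
      · simp [mul_sub, Finset.mul_sum]
      · simp
    have hmem : R • (Fin.snoc s (1 - ∑ i, s i) : Fin (m + 1) → ℝ)
        ∈ (Set.univ.pi fun _ : Fin (m + 1) => Set.Ici (0 : ℝ))
        ↔ s ∈ {s : Fin m → ℝ | (∀ i, 0 ≤ s i) ∧ ∑ i, s i ≤ 1} := by
      rw [Set.mem_univ_pi, Fin.forall_fin_succ']
      simp [hpos]
    rw [hpoint, hJ]
    by_cases h : s ∈ {s : Fin m → ℝ | (∀ i, 0 ≤ s i) ∧ ∑ i, s i ≤ 1}
    · rw [Set.indicator_of_mem h, Set.indicator_of_mem (hmem.2 h)]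
    · rw [Set.indicator_of_notMem h, Set.indicator_of_notMem (fun h' => h (hmem.1 h'))]

/-- On the simplex times the torus, `psi1` takes values in the unit sphere. -/
lemma sum_normSq_psi1 {m : ℕ} {s : Fin m → ℝ} (hs : (∀ i, 0 ≤ s i) ∧ ∑ i, s i ≤ 1)
    (t : Fin (m + 1) → ℝ) : ∑ i, Complex.normSq (psi1 (m + 1) (s, t) i) = 1 := by
  have hexp : ∀ x : ℝ, Complex.normSq (Complex.exp (Complex.I * x)) = 1 := fun x => by
    rw [Complex.normSq_eq_norm_sq, mul_comm, Complex.norm_exp_ofReal_mul_I, one_pow]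
  rw [Fin.sum_univ_castSucc]
  simp only [psi1, Fin.val_castSucc, Nat.add_sub_cancel, Fin.is_lt, dite_true, Fin.val_last,
    lt_irrefl, dite_false, map_mul, hexp, mul_one, Complex.normSq_ofReal]
  exact (congrArg₂ (· + ·) (Finset.sum_congr rfl fun i _ => Real.mul_self_sqrt (hs.1 i))
    (Real.mul_self_sqrt (sub_nonneg.2 hs.2))).trans (add_sub_cancel _ _)

lemma measurable_psi1 (n : ℕ) : Measurable (psi1 n) := by
  refine measurable_pi_iff.2 fun i => ?_
  unfold psi1
  split_ifs <;> fun_prop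

/-- Extend `G` from the unit sphere of `ℂ^n` to a function on the open unit ball that is constant
along rays, and by zero outside the ball. -/
noncomputable def radialExtension {n : ℕ} (G : (Fin n → ℂ) → ℝ≥0∞) (z : Fin n → ℂ) : ℝ≥0∞ :=
  if ∑ i, Complex.normSq (z i) < 1 then G ((√(∑ i, Complex.normSq (z i)))⁻¹ • z) else 0

lemma measurable_radialExtension {n : ℕ} {G : (Fin n → ℂ) → ℝ≥0∞} (hG : Measurable G) :
    Measurable (radialExtension G) := by
  have hN : Measurable fun z : Fin n → ℂ => ∑ i, Complex.normSq (z i) := by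
    have := Complex.continuous_normSq.measurable
    fun_prop
  exact Measurable.ite (measurableSet_lt hN measurable_const)
    (hG.comp (hN.sqrt.inv.smul measurable_id)) measurable_const

lemma radialExtension_sqrt_smul {n : ℕ} (G : (Fin n → ℂ) → ℝ≥0∞) {R : ℝ} (hR : 0 < R)
    {w : Fin n → ℂ} (hw : ∑ i, Complex.normSq (w i) = 1) :
    radialExtension G (√R • w) = (if R < 1 then 1 else 0) * G w := by
  have hN : ∑ i, Complex.normSq ((√R • w) i) = R := by
    simp only [Pi.smul_apply, Complex.real_smul, map_mul, Complex.normSq_ofReal,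
      Real.mul_self_sqrt hR.le, ← Finset.mul_sum, hw, mul_one]
  rw [radialExtension, hN, inv_smul_smul₀ (Real.sqrt_ne_zero'.2 hR), ite_mul, one_mul, zero_mul]

/-- Haar measure on the unit ball of `ℂ^(m+1)` disintegrates as a radial measure times the
push-forward under `psi1` of Lebesgue measure on the simplex times the torus. -/
lemma lintegral_radialExtension {m : ℕ} {G : (Fin (m + 1) → ℂ) → ℝ≥0∞} (hG : Measurable G) :
    ∫⁻ z, radialExtension G z
        ∂(Measure.pi fun _ : Fin (m + 1) => (2 : ℝ≥0∞) • (volume : Measure ℂ))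
      = (∫⁻ R in Set.Ioi (0 : ℝ), ENNReal.ofReal (R ^ m) * (if R < 1 then 1 else 0)) *
        ∫⁻ p in {s : Fin m → ℝ | (∀ i, 0 ≤ s i) ∧ ∑ i, s i ≤ 1} ×ˢ
          (Set.univ.pi fun _ : Fin (m + 1) => Set.Ico 0 (2 * Real.pi)), G (psi1 (m + 1) p) := by
  set T := {s : Fin m → ℝ | (∀ i, 0 ≤ s i) ∧ ∑ i, s i ≤ 1} with hTdef
  have hT : MeasurableSet T := by
    rw [hTdef]
    measurability
  have hF := measurable_radialExtension hG
  have : Measure.IsAddHaarMeasure ((2 : ℝ≥0∞) • (volume : Measure ℂ)) :=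
    Measure.IsAddHaarMeasure.smul _ (by simp) (by simp)
  have hΘ := (measurePreserving_pi
    (fun _ : Fin (m + 1) => (volume.restrict (Set.Ici (0 : ℝ))).prod
      (volume.restrict (Set.Ico 0 (2 * Real.pi)))) _
    fun _ => measurePreserving_sqrt_mul_exp).comp
    (measurePreserving_arrowProdEquivProdArrow ℝ ℝ (Fin (m + 1))
      (fun _ => volume.restrict (Set.Ici (0 : ℝ)))
      (fun _ => volume.restrict (Set.Ico 0 (2 * Real.pi)))).symm
  simp only [← Measure.restrict_pi_pi, ← volume_pi] at hΘ
  have hmeas := hF.comp hΘ.measurable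
  have hGψ : Measurable fun p : (Fin m → ℝ) × (Fin (m + 1) → ℝ) => G (psi1 (m + 1) p) :=
    hG.comp (measurable_psi1 _)
  rw [← hΘ.lintegral_comp hF]
  refine (lintegral_prod_symm _ hmeas.aemeasurable).trans ?_
  rw [Measure.volume_eq_prod, ← Measure.prod_restrict,
    lintegral_prod_symm _ hGψ.aemeasurable, ← lintegral_const_mul'']
  · refine lintegral_congr fun t => ?_
    refine (lintegral_pi_Ici_eq_lintegral_simplex
      (hmeas.comp (measurable_id.prodMk measurable_const))).trans ?_
    rw [← lintegral_mul_const]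
    · refine setLIntegral_congr_fun measurableSet_Ioi fun R hR => ?_
      have hR0 : (0 : ℝ) < R := hR
      rw [mul_assoc]
      congr 1
      rw [← lintegral_const_mul' _ _ (by split_ifs <;> simp)]
      refine setLIntegral_congr_fun hT fun s hs => ?_
      rw [← radialExtension_sqrt_smul G hR0 (sum_normSq_psi1 hs t)]
      simp only [Function.comp_apply]
      congr 1
      ext i
      refine Fin.lastCases ?_ (fun i => ?_) i
      · simp [psi1, MeasurableEquiv.arrowProdEquivProdArrow, Equiv.arrowProdEquivProdArrow,
          Real.sqrt_mul hR0.le, mul_assoc]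
      · simp [psi1, MeasurableEquiv.arrowProdEquivProdArrow, Equiv.arrowProdEquivProdArrow,
          Real.sqrt_mul hR0.le, mul_assoc]
    · exact Measurable.mul (by fun_prop)
        (Measurable.ite measurableSet_Iio measurable_const measurable_const)
  · exact hGψ.lintegral_prod_left'.aemeasurable

/-- The push-forward under `psi1` of Lebesgue measure on the simplex times the torus is invariant
under unitary matrices. -/
lemma measurePreserving_mulVec_map_psi1 {m : ℕ} {A : Matrix (Fin (m + 1)) (Fin (m + 1)) ℂ}
    (hA : A ∈ Matrix.unitaryGroup (Fin (m + 1)) ℂ) :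
    MeasurePreserving A.mulVec
      (Measure.map (psi1 (m + 1))
        (volume.restrict ({s : Fin m → ℝ | (∀ i, 0 ≤ s i) ∧ ∑ i, s i ≤ 1} ×ˢ
          (Set.univ.pi fun _ : Fin (m + 1) => Set.Ico 0 (2 * Real.pi)))))
      (Measure.map (psi1 (m + 1))
        (volume.restrict ({s : Fin m → ℝ | (∀ i, 0 ≤ s i) ∧ ∑ i, s i ≤ 1} ×ˢ
          (Set.univ.pi fun _ : Fin (m + 1) => Set.Ico 0 (2 * Real.pi))))) := by
  have hAm : Measurable A.mulVec :=
    (Continuous.matrix_mulVec continuous_const continuous_id).measurable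
  refine ⟨hAm, Measure.ext_of_lintegral _ fun G hG => ?_⟩
  rw [lintegral_map hG hAm,
    lintegral_map (f := fun v => G (A.mulVec v)) (hG.comp hAm) (measurable_psi1 _),
    lintegral_map hG (measurable_psi1 _)]
  have : Measure.IsAddHaarMeasure ((2 : ℝ≥0∞) • (volume : Measure ℂ)) :=
    Measure.IsAddHaarMeasure.smul _ (by simp) (by simp)
  have h := (measurePreserving_mulVec_of_mem_unitaryGroup hA
    (Measure.pi fun _ : Fin (m + 1) => (2 : ℝ≥0∞) • (volume : Measure ℂ))).lintegral_comp
    (measurable_radialExtension hG)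
  have hcomp : ∀ z, radialExtension G (A.mulVec z) = radialExtension (G ∘ A.mulVec) z := fun z => by
    simp only [radialExtension, sum_normSq_mulVec hA, Function.comp_apply, Matrix.mulVec_smul]
  simp only [hcomp] at h
  rw [lintegral_radialExtension hG, lintegral_radialExtension (hG.comp hAm)] at h
  refine (ENNReal.mul_right_inj ?_ ?_).1 h
  · rw [← pos_iff_ne_zero, lintegral_pos_iff_support (by
      exact Measurable.mul (by fun_prop)
        (Measurable.ite measurableSet_Iio measurable_const measurable_const)),
      Measure.restrict_apply' measurableSet_Ioi]
    refine lt_of_lt_of_le ?_ (measure_mono (s := Set.Ioo (0 : ℝ) 1) fun R hR => ⟨?_, hR.1⟩)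
    · simp
    · have : 0 < R ^ m := pow_pos hR.1 m
      simp [hR.2, this]
  · refine ne_top_of_le_ne_top (b := ∫⁻ R in Set.Ioi (0 : ℝ), (Set.Iio 1).indicator 1 R) ?_
      (setLIntegral_mono' measurableSet_Ioi fun R hR => ?_)
    · rw [lintegral_indicator_one measurableSet_Iio, Measure.restrict_apply measurableSet_Iio,
        Set.inter_comm, Set.Ioi_inter_Iio]
      simp
    · by_cases hR1 : R < 1
      · simpa [hR1] using pow_le_one₀ (le_of_lt hR) hR1.le
      · simp [hR1]

theorem stmt18 (n : ℕ) (hn : 1 ≤ n) (A : Matrix (Fin n) (Fin n) ℂ)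
    (hA : A ∈ Matrix.unitaryGroup (Fin n) ℂ) (f : (Fin n → ℂ) → ℝ)
    (hf : ContinuousOn f {v : Fin n → ℂ | ∑ i, Complex.normSq (v i) = 1}) :
    (∫ p in {p : (Fin (n - 1) → ℝ) × (Fin n → ℝ) |
        (∀ i, p.1 i ∈ Set.Icc (0 : ℝ) 1) ∧ (∑ i, p.1 i) ≤ 1 ∧
          ∀ j, p.2 j ∈ Set.Ico (0 : ℝ) (2 * Real.pi)},
        f (A.mulVec (psi1 n p)))
      = ∫ p in {p : (Fin (n - 1) → ℝ) × (Fin n → ℝ) |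
          (∀ i, p.1 i ∈ Set.Icc (0 : ℝ) 1) ∧ (∑ i, p.1 i) ≤ 1 ∧
            ∀ j, p.2 j ∈ Set.Ico (0 : ℝ) (2 * Real.pi)},
          f (psi1 n p) := by
  obtain ⟨m, rfl⟩ := Nat.exists_eq_add_of_le' hn
  have hset : {p : (Fin (m + 1 - 1) → ℝ) × (Fin (m + 1) → ℝ) |
      (∀ i, p.1 i ∈ Set.Icc (0 : ℝ) 1) ∧ (∑ i, p.1 i) ≤ 1 ∧
        ∀ j, p.2 j ∈ Set.Ico (0 : ℝ) (2 * Real.pi)}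
      = {s : Fin m → ℝ | (∀ i, 0 ≤ s i) ∧ ∑ i, s i ≤ 1} ×ˢ
          (Set.univ.pi fun _ : Fin (m + 1) => Set.Ico 0 (2 * Real.pi)) := by
    ext ⟨s, t⟩
    simp only [Set.mem_ofPred_eq, Set.mem_prod, Set.mem_univ_pi, Set.mem_Icc]
    refine ⟨fun h => ⟨⟨fun i => (h.1 i).1, h.2.1⟩, h.2.2⟩,
      fun h => ⟨fun i => ⟨h.1.1 i, ?_⟩, h.1.2, h.2⟩⟩
    exact (Finset.single_le_sum (fun j _ => h.1.1 j) (Finset.mem_univ i)).trans h.1.2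
  have hD : MeasurableSet ({s : Fin m → ℝ | (∀ i, 0 ≤ s i) ∧ ∑ i, s i ≤ 1} ×ˢ
      (Set.univ.pi fun _ : Fin (m + 1) => Set.Ico 0 (2 * Real.pi))) := by
    refine MeasurableSet.prod ?_ (MeasurableSet.univ_pi fun _ => measurableSet_Ico)
    measurability
  rw [hset]
  have hS : MeasurableSet {v : Fin (m + 1) → ℂ | ∑ i, Complex.normSq (v i) = 1} := by
    refine (isClosed_eq ?_ continuous_const).measurableSet
    exact continuous_finsetSum _ fun i _ => Complex.continuous_normSq.comp (continuous_apply i)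
  have hPA := measurePreserving_mulVec_map_psi1 hA
  set μ := (volume.restrict ({s : Fin m → ℝ | (∀ i, 0 ≤ s i) ∧ ∑ i, s i ≤ 1} ×ˢ
      (Set.univ.pi fun _ : Fin (m + 1) => Set.Ico 0 (2 * Real.pi))))
  have hsphere : Measure.map (psi1 (m + 1)) μ
      = (Measure.map (psi1 (m + 1)) μ).restrict {v | ∑ i, Complex.normSq (v i) = 1} := by
    refine (Measure.restrict_eq_self_of_ae_mem ?_).symm
    refine (ae_map_iff (measurable_psi1 _).aemeasurable hS).2 ?_
    filter_upwards [ae_restrict_mem hD] with p hp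
    exact sum_normSq_psi1 hp.1 p.2
  have hfm : AEStronglyMeasurable f (Measure.map (psi1 (m + 1)) μ) := by
    rw [hsphere]
    exact hf.aestronglyMeasurable hS
  calc ∫ p, f (A.mulVec (psi1 (m + 1) p)) ∂μ
      = ∫ v, f (A.mulVec v) ∂(Measure.map (psi1 (m + 1)) μ) :=
        (integral_map (measurable_psi1 _).aemeasurable
          (hfm.comp_measurePreserving hPA)).symm
    _ = ∫ v, f v ∂(Measure.map (psi1 (m + 1)) μ) := by
        conv_rhs => rw [← hPA.map_eq]
        exact (integral_map hPA.measurable.aemeasurable (by rwa [hPA.map_eq])).symm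
    _ = ∫ p, f (psi1 (m + 1) p) ∂μ := integral_map (measurable_psi1 _).aemeasurable hfm
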